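/- arXiv:2011.12653 — 2 statements merged into one kernel-verified Lean document; each statement's English description precedes it below -/
import Mathlib

section
/- Let A be a Banach algebra, X a Banach A-bimodule, and I a closed two-sided ideal of A such that Z(A, X*) = Z(I, X*), where Z(I, X*) = {f ∈ X* : i·f = f·i for all i ∈ I}. Suppose that every biderivation from I × I into X* (with X* regarded as an I-bimodule by restricting the actions) equals Δ_φ for some φ ∈ Z(I, X*), and that the quotient Banach algebra A/I is biamenable. Then every biderivation from A × A into X* is an inner biderivation. -/
noncomputable section

universe u v

/-- A Banach `A`-bimodule: a Banach space `X` with continuous (bounded bilinear) left and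
right `A`-actions satisfying `(a·x)·b = a·(x·b)`.  Here `l a x = a·x` and `r a x = x·a`. -/
structure BanachBimodule (A : Type u) (X : Type v) [NonUnitalNormedRing A]
    [NormedSpace ℂ A] [NormedAddCommGroup X] [NormedSpace ℂ X] : Type (max u v) where
  l : A →L[ℂ] X →L[ℂ] X
  r : A →L[ℂ] X →L[ℂ] X
  l_mul : ∀ a b x, l (a * b) x = l a (l b x)
  r_mul : ∀ a b x, r (a * b) x = r b (r a x)
  lr_assoc : ∀ a b x, r b (l a x) = l a (r b x)

namespace BanachBimodule

variable {A : Type u} {X : Type v} [NonUnitalNormedRing A] [NormedSpace ℂ A]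
  [NormedAddCommGroup X] [NormedSpace ℂ X]

/-- The dual Banach `A`-bimodule structure on `X* = X →L[ℂ] ℂ`, with
`(a·f)(x) = f(x·a)` and `(f·a)(x) = f(a·x)`. -/
def dual (M : BanachBimodule A X) : BanachBimodule A (X →L[ℂ] ℂ) where
  l := (ContinuousLinearMap.compL ℂ X X ℂ).flip.comp M.r
  r := (ContinuousLinearMap.compL ℂ X X ℂ).flip.comp M.l
  l_mul := by
    intro a b f
    ext x
    simp [M.r_mul]
  r_mul := by
    intro a b f
    ext x
    simp [M.l_mul]
  lr_assoc := by
    intro a b f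
    ext x
    simp [M.lr_assoc]

/-- `Z(A, X)`: the set of elements of `X` commuting with every element of `A`. -/
def center (M : BanachBimodule A X) : Set X := {x | ∀ a : A, M.l a x = M.r a x}

end BanachBimodule

/-- A biderivation `D : A × A → X`: a bounded bilinear map which is a derivation in each
variable: `D(ac, b) = a·D(c,b) + D(a,b)·c` and `D(a, bc) = b·D(a,c) + D(a,b)·c`. -/
def IsBiderivation {A : Type u} {X : Type v} [NonUnitalNormedRing A] [NormedSpace ℂ A]
    [NormedAddCommGroup X] [NormedSpace ℂ X] (M : BanachBimodule A X)
    (D : A →L[ℂ] A →L[ℂ] X) : Prop :=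
  (∀ a b c : A, D (a * c) b = M.l a (D c b) + M.r c (D a b)) ∧
  (∀ a b c : A, D a (b * c) = M.l b (D a c) + M.r c (D a b))

/-- An inner biderivation: `Δ_x (a, b) = x·(ab - ba)` for some `x ∈ Z(A, X)`. -/
def IsInnerBiderivation {A : Type u} {X : Type v} [NonUnitalNormedRing A] [NormedSpace ℂ A]
    [NormedAddCommGroup X] [NormedSpace ℂ X] (M : BanachBimodule A X)
    (D : A →L[ℂ] A →L[ℂ] X) : Prop :=
  ∃ x ∈ M.center, ∀ a b : A, D a b = M.r (a * b - b * a) x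

/-- A Banach algebra `A` is biamenable if for every Banach `A`-bimodule `X`, every
biderivation from `A × A` into the dual module `X*` is inner. -/
def Biamenable (A : Type u) [NonUnitalNormedRing A] [NormedSpace ℂ A]
    [IsScalarTower ℂ A A] [SMulCommClass ℂ A A] [CompleteSpace A] : Prop :=
  ∀ (X : Type v) [NormedAddCommGroup X] [NormedSpace ℂ X] [CompleteSpace X]
    (M : BanachBimodule A X) (D : A →L[ℂ] A →L[ℂ] (X →L[ℂ] ℂ)),
    IsBiderivation M.dual D → IsInnerBiderivation M.dual D

section QuotientAlgebra

variable {A : Type u} [NonUnitalNormedRing A] [NormedSpace ℂ A]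

/-- Multiplication on the quotient of `A` by a two-sided ideal `I`. -/
def quotMul (I : Submodule ℂ A) (hl : ∀ (a : A), ∀ x ∈ I, a * x ∈ I)
    (hr : ∀ (a : A), ∀ x ∈ I, x * a ∈ I) : Mul (A ⧸ I) where
  mul := Quotient.map₂ (· * ·) <| by
    intro a b hab c d hcd
    have hab' : a - b ∈ I := (Submodule.quotientRel_def I).mp hab
    have hcd' : c - d ∈ I := (Submodule.quotientRel_def I).mp hcd
    refine (Submodule.quotientRel_def I).mpr ?_
    have : a * c - b * d = a * (c - d) + (a - b) * d := by noncomm_ring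
    rw [this]
    exact I.add_mem (hl a _ hcd') (hr d _ hab')

theorem quotMul_mk (I : Submodule ℂ A) (hl : ∀ (a : A), ∀ x ∈ I, a * x ∈ I)
    (hr : ∀ (a : A), ∀ x ∈ I, x * a ∈ I) (a b : A) :
    (quotMul I hl hr).mul (Submodule.Quotient.mk a) (Submodule.Quotient.mk b) =
      Submodule.Quotient.mk (a * b) := rfl

/-- The quotient of a Banach algebra `A` by a closed two-sided ideal `I`, as a (nonunital)
normed ring. -/
@[reducible] def quotNonUnitalNormedRing (I : Submodule ℂ A) (hl : ∀ (a : A), ∀ x ∈ I, a * x ∈ I)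
    (hr : ∀ (a : A), ∀ x ∈ I, x * a ∈ I) (hc : IsClosed (I : Set A)) :
    NonUnitalNormedRing (A ⧸ I) :=
  letI : IsClosed (I : Set A) := hc
  letI m : Mul (A ⧸ I) := quotMul I hl hr
  { (inferInstance : NormedAddCommGroup (A ⧸ I)), m with
    left_distrib := by
      rintro ⟨a⟩ ⟨b⟩ ⟨c⟩
      exact congrArg Submodule.Quotient.mk (left_distrib a b c)
    right_distrib := by
      rintro ⟨a⟩ ⟨b⟩ ⟨c⟩
      exact congrArg Submodule.Quotient.mk (right_distrib a b c)
    zero_mul := by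
      rintro ⟨a⟩
      exact congrArg Submodule.Quotient.mk (zero_mul a)
    mul_zero := by
      rintro ⟨a⟩
      exact congrArg Submodule.Quotient.mk (mul_zero a)
    mul_assoc := by
      rintro ⟨a⟩ ⟨b⟩ ⟨c⟩
      exact congrArg Submodule.Quotient.mk (mul_assoc a b c)
    norm_mul_le := by
      intro x y
      refine le_of_forall_pos_le_add fun ε hε => ?_
      have := ((Metric.nhds_basis_ball.prod_nhds Metric.nhds_basis_ball).tendsto_iff Metric.nhds_basis_ball).mp
        (continuous_mul.tendsto (‖x‖, ‖y‖)) ε hε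
      simp only [Set.mem_prod, Metric.mem_ball, and_imp, Prod.forall, exists_prop,
        Prod.exists] at this
      rcases this with ⟨ε₁, ε₂, ⟨h₁, h₂⟩, h⟩
      obtain ⟨⟨a, rfl, ha⟩, ⟨b, rfl, hb⟩⟩ := Submodule.Quotient.norm_mk_lt x h₁,
        Submodule.Quotient.norm_mk_lt y h₂
      simp only [dist, abs_sub_lt_iff] at h
      specialize h ‖a‖ ‖b‖ ⟨by linarith, by linarith [Submodule.Quotient.norm_mk_le I a]⟩
        ⟨by linarith, by linarith [Submodule.Quotient.norm_mk_le I b]⟩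
      calc
        _ ≤ ‖a * b‖ := Submodule.Quotient.norm_mk_le I (a * b)
        _ ≤ ‖a‖ * ‖b‖ := norm_mul_le a b
        _ ≤ _ := (sub_lt_iff_lt_add'.mp h.1).le }

end QuotientAlgebra

section QuotientAlgebraSMul

variable {A : Type u} [NonUnitalNormedRing A] [NormedSpace ℂ A]

theorem quotIsScalarTower [IsScalarTower ℂ A A] (I : Submodule ℂ A)
    (hl : ∀ (a : A), ∀ x ∈ I, a * x ∈ I) (hr : ∀ (a : A), ∀ x ∈ I, x * a ∈ I) :
    letI := quotMul I hl hr
    IsScalarTower ℂ (A ⧸ I) (A ⧸ I) := by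
  letI := quotMul I hl hr
  refine ⟨?_⟩
  rintro c ⟨a⟩ ⟨b⟩
  exact congrArg Submodule.Quotient.mk (smul_mul_assoc c a b)

theorem quotSMulCommClass [SMulCommClass ℂ A A] (I : Submodule ℂ A)
    (hl : ∀ (a : A), ∀ x ∈ I, a * x ∈ I) (hr : ∀ (a : A), ∀ x ∈ I, x * a ∈ I) :
    letI := quotMul I hl hr
    SMulCommClass ℂ (A ⧸ I) (A ⧸ I) := by
  letI := quotMul I hl hr
  refine ⟨?_⟩
  rintro c ⟨a⟩ ⟨b⟩
  exact congrArg Submodule.Quotient.mk (mul_smul_comm c a b).symm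

end QuotientAlgebraSMul

section Subalgebra

variable {A : Type u} [NonUnitalNormedRing A] [NormedSpace ℂ A]

/-- A closed two-sided ideal `I` of a Banach algebra `A` is itself a (nonunital) normed
algebra with the restricted operations. -/
@[reducible] def subNonUnitalNormedRing (I : Submodule ℂ A) (hl : ∀ (a : A), ∀ x ∈ I, a * x ∈ I) :
    NonUnitalNormedRing ↥I :=
  { (inferInstance : NormedAddCommGroup ↥I) with
    mul := fun x y => ⟨(x : A) * (y : A), hl x _ y.2⟩
    left_distrib := fun x y z => Subtype.ext (left_distrib (x : A) y z)
    right_distrib := fun x y z => Subtype.ext (right_distrib (x : A) y z)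
    zero_mul := fun x => Subtype.ext (zero_mul (x : A))
    mul_zero := fun x => Subtype.ext (mul_zero (x : A))
    mul_assoc := fun x y z => Subtype.ext (mul_assoc (x : A) y z)
    norm_mul_le := fun x y => norm_mul_le (x : A) (y : A) }

universe u'

/-- Pulling back a Banach `A`-bimodule structure along a continuous multiplicative linear
map `T : E → A`:  `e·x = T(e)·x` and `x·e = x·T(e)`. -/
def BanachBimodule.pullback {E : Type u'} {X : Type v}
    [NonUnitalNormedRing E] [NormedSpace ℂ E]
    [NormedAddCommGroup X] [NormedSpace ℂ X] (M : BanachBimodule A X)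
    (T : E →L[ℂ] A) (hT : ∀ e e' : E, T (e * e') = T e * T e') : BanachBimodule E X where
  l := M.l.comp T
  r := M.r.comp T
  l_mul := by intro a b x; simp [hT, M.l_mul]
  r_mul := by intro a b x; simp [hT, M.r_mul]
  lr_assoc := by intro a b x; simp [M.lr_assoc]

end Subalgebra

section QuotientLift

variable {E F G : Type*} [NormedAddCommGroup E] [NormedSpace ℂ E] [NormedAddCommGroup F]
  [NormedSpace ℂ F] [NormedAddCommGroup G] [NormedSpace ℂ G]

/-- A bounded bilinear map that vanishes on `S` in the first variable and on `K` in the second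
one descends to the quotients. -/
def quotLift₂ (S : Submodule ℂ E) (K : Submodule ℂ F) (B : E →L[ℂ] F →L[ℂ] G)
    (hS : ∀ e ∈ S, B e = 0) (hK : ∀ e, ∀ x ∈ K, B e x = 0) :
    (E ⧸ S) →L[ℂ] (F ⧸ K) →L[ℂ] G :=
  (K.liftQL (S.liftQL B fun e he => hS e he).flip fun x hx => by
    ext ⟨e⟩
    exact hK e x hx).flip

/-- A bounded bilinear map into a dual space that vanishes on `S` in each variable and whose values
vanish on `K` descends to the quotients. -/
def quotLiftDual₂ (S : Submodule ℂ E) (K : Submodule ℂ F) (D : E →L[ℂ] E →L[ℂ] (F →L[ℂ] ℂ))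
    (hl : ∀ s ∈ S, ∀ e, D s e = 0) (hr : ∀ e, ∀ s ∈ S, D e s = 0)
    (hK : ∀ e e', ∀ x ∈ K, D e e' x = 0) :
    (E ⧸ S) →L[ℂ] (E ⧸ S) →L[ℂ] ((F ⧸ K) →L[ℂ] ℂ) :=
  (ContinuousLinearMap.flipₗᵢ ℂ (F ⧸ K) (E ⧸ S) ℂ).toContinuousLinearEquiv.toContinuousLinearMap.comp
    (K.liftQL
      ((ContinuousLinearMap.flipₗᵢ ℂ (E ⧸ S) F ℂ).toContinuousLinearEquiv.toContinuousLinearMap.comp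
        (quotLift₂ S S D (fun s hs => ContinuousLinearMap.ext (hl s hs)) hr)).flip
      fun x hx => by
        ext ⟨e⟩ ⟨e'⟩
        exact hK e e' x hx).flip

end QuotientLift

section Biderivation

variable {A : Type u} {Y : Type v} [NonUnitalNormedRing A] [NormedSpace ℂ A]
  [NormedAddCommGroup Y] [NormedSpace ℂ Y]

theorem IsBiderivation.flip {M : BanachBimodule A Y} {D : A →L[ℂ] A →L[ℂ] Y}
    (h : IsBiderivation M D) : IsBiderivation M D.flip :=
  ⟨fun a b c => h.2 b a c, fun a b c => h.1 b a c⟩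

theorem IsBiderivation.sub {M : BanachBimodule A Y} {D D' : A →L[ℂ] A →L[ℂ] Y}
    (h : IsBiderivation M D) (h' : IsBiderivation M D') : IsBiderivation M (D - D') := by
  constructor
  · intro a b c
    simp only [sub_apply, h.1 a b c, h'.1 a b c, map_sub]
    abel
  · intro a b c
    simp only [sub_apply, h.2 a b c, h'.2 a b c, map_sub]
    abel

theorem IsBiderivation.restrict {M : BanachBimodule A Y} {D : A →L[ℂ] A →L[ℂ] Y}
    (h : IsBiderivation M D) {I : Submodule ℂ A} (hl : ∀ (a : A), ∀ x ∈ I, a * x ∈ I) :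
    letI : NonUnitalNormedRing ↥I := subNonUnitalNormedRing I hl
    IsBiderivation (M.pullback I.subtypeL (fun _ _ => rfl))
      (D.bilinearComp I.subtypeL I.subtypeL) :=
  ⟨fun a b c => h.1 (a : A) b c, fun a b c => h.2 (a : A) b c⟩

/-- The bounded bilinear map `(a, b) ↦ y·(ab - ba)`. -/
def innerBilinear [IsScalarTower ℂ A A] [SMulCommClass ℂ A A] (M : BanachBimodule A Y) (y : Y) :
    A →L[ℂ] A →L[ℂ] Y :=
  (ContinuousLinearMap.compL ℂ A A Y (M.r.flip y)).comp
    (ContinuousLinearMap.mul ℂ A - (ContinuousLinearMap.mul ℂ A).flip)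

@[simp] theorem innerBilinear_apply [IsScalarTower ℂ A A] [SMulCommClass ℂ A A]
    (M : BanachBimodule A Y) (y : Y) (a b : A) :
    innerBilinear M y a b = M.r (a * b - b * a) y :=
  rfl

theorem isBiderivation_innerBilinear [IsScalarTower ℂ A A] [SMulCommClass ℂ A A]
    {M : BanachBimodule A Y} {y : Y} (hy : y ∈ M.center) :
    IsBiderivation M (innerBilinear M y) := by
  have hl : ∀ a b, M.l a (M.r b y) = M.r (a * b) y := fun a b => by
    rw [← M.lr_assoc, hy a, M.r_mul]
  constructor
  · intro a b c
    simp only [innerBilinear_apply, hl, ← M.r_mul, ← add_apply, ← map_add]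
    congr 2
    noncomm_ring
  · intro a b c
    simp only [innerBilinear_apply, hl, ← M.r_mul, ← add_apply, ← map_add]
    congr 2
    noncomm_ring

namespace BanachBimodule

/-- The elements of a bimodule that are annihilated by `I` on both sides. -/
def annihilator (M : BanachBimodule A Y) (I : Submodule ℂ A) : Submodule ℂ Y where
  carrier := {y | ∀ i ∈ I, M.l i y = 0 ∧ M.r i y = 0}
  zero_mem' := by simp
  add_mem' := by
    intro x y hx hy i hi
    simp [hx i hi, hy i hi]
  smul_mem' := by
    intro c x hx i hi
    simp [hx i hi]

theorem l_mem_annihilator (M : BanachBimodule A Y) {I : Submodule ℂ A}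
    (hr : ∀ (a : A), ∀ x ∈ I, x * a ∈ I) (a : A) {y : Y} (hy : y ∈ M.annihilator I) :
    M.l a y ∈ M.annihilator I := fun i hi =>
  ⟨by rw [← M.l_mul, (hy _ (hr a i hi)).1], by rw [M.lr_assoc, (hy i hi).2, map_zero]⟩

theorem r_mem_annihilator (M : BanachBimodule A Y) {I : Submodule ℂ A}
    (hl : ∀ (a : A), ∀ x ∈ I, a * x ∈ I) (a : A) {y : Y} (hy : y ∈ M.annihilator I) :
    M.r a y ∈ M.annihilator I := fun i hi =>
  ⟨by rw [← M.lr_assoc, (hy i hi).1, map_zero], by rw [← M.r_mul, (hy _ (hl a i hi)).2]⟩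

end BanachBimodule

/-- If every biderivation on a two-sided ideal `I` is inner, then a biderivation that vanishes on
`I × I` vanishes on `A × I`. -/
theorem IsBiderivation.apply_eq_zero_of_mem {M : BanachBimodule A Y} {I : Submodule ℂ A}
    (hl : ∀ (a : A), ∀ x ∈ I, a * x ∈ I) (hr : ∀ (a : A), ∀ x ∈ I, x * a ∈ I)
    (hI : letI : NonUnitalNormedRing ↥I := subNonUnitalNormedRing I hl
      ∀ D₀ : ↥I →L[ℂ] ↥I →L[ℂ] Y,
        IsBiderivation (M.pullback I.subtypeL (fun _ _ => rfl)) D₀ →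
          IsInnerBiderivation (M.pullback I.subtypeL (fun _ _ => rfl)) D₀)
    {D : A →L[ℂ] A →L[ℂ] Y} (hD : IsBiderivation M D)
    (h0 : ∀ i ∈ I, ∀ j ∈ I, D i j = 0) (a : A) {j : A} (hj : j ∈ I) : D a j = 0 := by
  have hN : ∀ k ∈ I, D a k ∈ M.annihilator I := by
    intro k hk i hi
    constructor
    · have := hD.1 i k a
      rw [h0 _ (hr a i hi) k hk, h0 i hi k hk, map_zero, add_zero] at this
      exact this.symm
    · have := hD.1 a k i
      rw [h0 _ (hl a i hi) k hk, h0 i hi k hk, map_zero, zero_add] at this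
      exact this.symm
  have hsq : ∀ i ∈ I, ∀ k ∈ I, D a (i * k) = 0 := by
    intro i hi k hk
    rw [hD.2, (hN k hk i hi).1, (hN i hi k hk).2, add_zero]
  by_contra hne
  obtain ⟨g, hg⟩ := SeparatingDual.exists_ne_zero (R := ℂ) hne
  let : NonUnitalNormedRing ↥I := subNonUnitalNormedRing I hl
  let lam : ↥I →L[ℂ] ℂ := (g.comp (D a)).comp I.subtypeL
  have hlam : ∀ i k : ↥I, lam (i * k) = 0 := fun i k => by
    change g (D a ((i : A) * k)) = 0
    rw [hsq i i.2 k k.2, map_zero]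
  obtain ⟨y, -, hy⟩ := hI (lam.smulRight (lam.smulRight (D a j))) <| by
    have hkill : ∀ (i : ↥I) (z : ℂ), M.l (i : A) (z • D a j) = 0 ∧ M.r (i : A) (z • D a j) = 0 :=
      fun i z => (M.annihilator I).smul_mem z (hN j hj) i i.2
    constructor
    · intro i k m
      change lam (i * m) • lam k • D a j =
        M.l (i : A) (lam m • lam k • D a j) + M.r (m : A) (lam i • lam k • D a j)
      simp only [smul_smul, hkill, hlam, zero_mul, zero_smul, add_zero]
    · intro i k m
      change lam i • lam (k * m) • D a j =
        M.l (k : A) (lam i • lam m • D a j) + M.r (m : A) (lam i • lam k • D a j)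
      simp only [smul_smul, hkill, hlam, zero_smul, smul_zero, add_zero]
  have hjj := hy ⟨j, hj⟩ ⟨j, hj⟩
  rw [sub_self, map_zero] at hjj
  change g (D a j) • g (D a j) • D a j = 0 at hjj
  exact hne (by simpa [hg] using hjj)

end Biderivation

namespace BanachBimodule

variable {A : Type u} {X : Type v} [NonUnitalNormedRing A] [NormedSpace ℂ A]
  [NormedAddCommGroup X] [NormedSpace ℂ X]

/-- The common kernel of the functionals that are annihilated by `I` on both sides. -/
def preannihilator (M : BanachBimodule A X) (I : Submodule ℂ A) : Submodule ℂ X :=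
  ⨅ f ∈ M.dual.annihilator I, f.ker

theorem mem_preannihilator {M : BanachBimodule A X} {I : Submodule ℂ A} {x : X} :
    x ∈ M.preannihilator I ↔ ∀ f ∈ M.dual.annihilator I, f x = 0 := by
  simp [preannihilator]

instance isClosed_preannihilator (M : BanachBimodule A X) (I : Submodule ℂ A) :
    IsClosed (M.preannihilator I : Set X) := by
  simp only [preannihilator, Submodule.coe_iInf]
  exact isClosed_biInter fun f _ => f.isClosed_ker

theorem l_mem_preannihilator (M : BanachBimodule A X) {I : Submodule ℂ A} {i : A} (hi : i ∈ I)
    (x : X) : M.l i x ∈ M.preannihilator I :=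
  mem_preannihilator.2 fun _ hf => DFunLike.congr_fun (hf i hi).2 x

theorem r_mem_preannihilator (M : BanachBimodule A X) {I : Submodule ℂ A} {i : A} (hi : i ∈ I)
    (x : X) : M.r i x ∈ M.preannihilator I :=
  mem_preannihilator.2 fun _ hf => DFunLike.congr_fun (hf i hi).1 x

/-- The quotient of `X` by the preannihilator of `I`, as a Banach bimodule over `A ⧸ I`. -/
def quotient (M : BanachBimodule A X) (I : Submodule ℂ A) (hl : ∀ (a : A), ∀ x ∈ I, a * x ∈ I)
    (hr : ∀ (a : A), ∀ x ∈ I, x * a ∈ I) (hc : IsClosed (I : Set A)) :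
    letI : NonUnitalNormedRing (A ⧸ I) := quotNonUnitalNormedRing I hl hr hc
    BanachBimodule (A ⧸ I) (X ⧸ M.preannihilator I) :=
  letI : NonUnitalNormedRing (A ⧸ I) := quotNonUnitalNormedRing I hl hr hc
  { l := quotLift₂ I (M.preannihilator I)
      ((ContinuousLinearMap.compL ℂ X X _ (M.preannihilator I).mkQL).comp M.l)
      (fun i hi => by
        ext x
        exact (Submodule.Quotient.mk_eq_zero _).2 (M.l_mem_preannihilator hi x))
      (fun a x hx => (Submodule.Quotient.mk_eq_zero _).2 <| mem_preannihilator.2 fun f hf =>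
        mem_preannihilator.1 hx _ (M.dual.r_mem_annihilator hl a hf))
    r := quotLift₂ I (M.preannihilator I)
      ((ContinuousLinearMap.compL ℂ X X _ (M.preannihilator I).mkQL).comp M.r)
      (fun i hi => by
        ext x
        exact (Submodule.Quotient.mk_eq_zero _).2 (M.r_mem_preannihilator hi x))
      (fun a x hx => (Submodule.Quotient.mk_eq_zero _).2 <| mem_preannihilator.2 fun f hf =>
        mem_preannihilator.1 hx _ (M.dual.l_mem_annihilator hr a hf))
    l_mul := by
      rintro ⟨a⟩ ⟨b⟩ ⟨x⟩
      exact congrArg Submodule.Quotient.mk (M.l_mul a b x)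
    r_mul := by
      rintro ⟨a⟩ ⟨b⟩ ⟨x⟩
      exact congrArg Submodule.Quotient.mk (M.r_mul a b x)
    lr_assoc := by
      rintro ⟨a⟩ ⟨b⟩ ⟨x⟩
      exact congrArg Submodule.Quotient.mk (M.lr_assoc a b x) }

end BanachBimodule

/-- If `A ⧸ I` is biamenable, then a biderivation into a dual bimodule that vanishes on `A × I`
and on `I × A` is inner. -/
theorem IsBiderivation.isInner_of_quotient {A : Type u} {X : Type v}
    [NonUnitalNormedRing A] [NormedSpace ℂ A] [IsScalarTower ℂ A A] [SMulCommClass ℂ A A]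
    [CompleteSpace A] [NormedAddCommGroup X] [NormedSpace ℂ X] [CompleteSpace X]
    {M : BanachBimodule A X} {I : Submodule ℂ A} (hl : ∀ (a : A), ∀ x ∈ I, a * x ∈ I)
    (hr : ∀ (a : A), ∀ x ∈ I, x * a ∈ I) (hc : IsClosed (I : Set A))
    (hQ : letI : NonUnitalNormedRing (A ⧸ I) := quotNonUnitalNormedRing I hl hr hc
      letI : IsScalarTower ℂ (A ⧸ I) (A ⧸ I) := quotIsScalarTower I hl hr
      letI : SMulCommClass ℂ (A ⧸ I) (A ⧸ I) := quotSMulCommClass I hl hr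
      Biamenable.{u, v} (A ⧸ I))
    {D : A →L[ℂ] A →L[ℂ] (X →L[ℂ] ℂ)} (hD : IsBiderivation M.dual D)
    (hAI : ∀ a, ∀ i ∈ I, D a i = 0) (hIA : ∀ i ∈ I, ∀ a, D i a = 0) :
    IsInnerBiderivation M.dual D := by
  have hN : ∀ a b, D a b ∈ M.dual.annihilator I := by
    intro a b i hi
    constructor
    · have := hD.1 i b a
      rw [hIA _ (hr a i hi), hIA i hi, map_zero, add_zero] at this
      exact this.symm
    · have := hD.1 a b i
      rw [hIA _ (hl a i hi), hIA i hi, map_zero, zero_add] at this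
      exact this.symm
  let DQ := quotLiftDual₂ I (M.preannihilator I) D hIA hAI fun a b x hx =>
    BanachBimodule.mem_preannihilator.1 hx _ (hN a b)
  let : NonUnitalNormedRing (A ⧸ I) := quotNonUnitalNormedRing I hl hr hc
  obtain ⟨f, hf, hfD⟩ := hQ (X ⧸ M.preannihilator I) (M.quotient I hl hr hc) DQ <| by
    constructor
    · rintro ⟨a⟩ ⟨b⟩ ⟨c⟩
      ext ⟨x⟩
      exact DFunLike.congr_fun (hD.1 a b c) x
    · rintro ⟨a⟩ ⟨b⟩ ⟨c⟩
      ext ⟨x⟩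
      exact DFunLike.congr_fun (hD.2 a b c) x
  refine ⟨f.comp (M.preannihilator I).mkQL, fun a => ?_, fun a b => ?_⟩
  · ext x
    exact DFunLike.congr_fun (hf (Submodule.Quotient.mk a)) (Submodule.Quotient.mk x)
  · ext x
    exact DFunLike.congr_fun (hfD (Submodule.Quotient.mk a) (Submodule.Quotient.mk b))
      (Submodule.Quotient.mk x)

/-- let `X` be a Banach `A`-bimodule and `I` a closed two-sided ideal of `A`
with `Z(A, X*) = Z(I, X*)`.  If every biderivation from `I × I` into `X*` (with the
restricted actions) is inner, and the quotient Banach algebra `A ⧸ I` is biamenable, then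
every biderivation from `A × A` into `X*` is inner. -/
theorem biderivation_inner_of_ideal {A : Type u} {X : Type v}
    [NonUnitalNormedRing A] [NormedSpace ℂ A] [IsScalarTower ℂ A A] [SMulCommClass ℂ A A]
    [CompleteSpace A] [NormedAddCommGroup X] [NormedSpace ℂ X] [CompleteSpace X]
    (M : BanachBimodule A X)
    (I : Submodule ℂ A) (hl : ∀ (a : A), ∀ x ∈ I, a * x ∈ I)
    (hr : ∀ (a : A), ∀ x ∈ I, x * a ∈ I) (hc : IsClosed (I : Set A)) :
    -- `I`, as a Banach algebra with the restricted operations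
    letI : NonUnitalNormedRing ↥I := subNonUnitalNormedRing I hl
    -- `Z(A, X*) = Z(I, X*)`
    (M.dual.center = {f : X →L[ℂ] ℂ | ∀ a : A, a ∈ I → M.dual.l a f = M.dual.r a f}) →
    -- every biderivation from `I × I` into `X*` is inner (i.e. equals `Δ_φ` for some
    -- `φ ∈ Z(I, X*)`)
    (∀ D₀ : ↥I →L[ℂ] ↥I →L[ℂ] (X →L[ℂ] ℂ),
        IsBiderivation (M.dual.pullback I.subtypeL (fun _ _ => rfl)) D₀ →
          IsInnerBiderivation (M.dual.pullback I.subtypeL (fun _ _ => rfl)) D₀) →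
    -- the quotient `A ⧸ I` is biamenable
    (letI : NonUnitalNormedRing (A ⧸ I) := quotNonUnitalNormedRing I hl hr hc
     letI : IsScalarTower ℂ (A ⧸ I) (A ⧸ I) := quotIsScalarTower I hl hr
     letI : SMulCommClass ℂ (A ⧸ I) (A ⧸ I) := quotSMulCommClass I hl hr
     Biamenable.{u, v} (A ⧸ I)) →
    -- conclusion: every biderivation from `A × A` into `X*` is inner
    ∀ D : A →L[ℂ] A →L[ℂ] (X →L[ℂ] ℂ),
      IsBiderivation M.dual D → IsInnerBiderivation M.dual D := by
  intro hZ hI hQ D hD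
  obtain ⟨f, hf, hfD⟩ := hI _ (hD.restrict hl)
  have hfA : f ∈ M.dual.center := by
    rw [hZ]
    exact fun i hi => hf ⟨i, hi⟩
  obtain ⟨E, hE, hED⟩ : ∃ E : A →L[ℂ] A →L[ℂ] (X →L[ℂ] ℂ), IsBiderivation M.dual E ∧
      ∀ a b, E a b = D a b - M.dual.r (a * b - b * a) f :=
    ⟨_, hD.sub (isBiderivation_innerBilinear hfA), fun _ _ => rfl⟩
  have hE0 : ∀ i ∈ I, ∀ j ∈ I, E i j = 0 := fun i hi j hj =>
    (hED i j).trans (sub_eq_zero.2 (hfD ⟨i, hi⟩ ⟨j, hj⟩))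
  obtain ⟨g, hg, hgE⟩ := hE.isInner_of_quotient hl hr hc hQ
    (fun a i hi => hE.apply_eq_zero_of_mem hl hr hI hE0 a hi)
    (fun i hi a => hE.flip.apply_eq_zero_of_mem hl hr hI (fun j hj k hk => hE0 k hk j hj) a hi)
  refine ⟨g + f, fun a => by rw [map_add, map_add, hg a, hfA a], fun a b => ?_⟩
  rw [map_add, ← hgE, hED, sub_add_cancel]
end
end

section
/- If A is a biamenable Banach algebra and I is a closed two-sided ideal of A, then the quotient Banach algebra A/I is biamenable. -/
noncomputable section

universe u v

namespace BanachBimodule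

variable {A B : Type*} {X : Type*} [NonUnitalNormedRing A] [NormedSpace ℂ A]
  [NonUnitalNormedRing B] [NormedSpace ℂ B] [NormedAddCommGroup X] [NormedSpace ℂ X]

/-- Restriction of scalars of a Banach bimodule along a bounded homomorphism. -/
def restrictScalars (M : BanachBimodule B X) (φ : A →L[ℂ] B)
    (hφ : ∀ a b, φ (a * b) = φ a * φ b) : BanachBimodule A X where
  l := M.l.comp φ
  r := M.r.comp φ
  l_mul a b x := by simp [hφ, M.l_mul]
  r_mul a b x := by simp [hφ, M.r_mul]
  lr_assoc a b x := M.lr_assoc (φ a) (φ b) x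

end BanachBimodule

/-- Biamenability passes to the range of a surjective bounded homomorphism. -/
theorem Biamenable.of_surjective {A B : Type u} [NonUnitalNormedRing A] [NormedSpace ℂ A]
    [IsScalarTower ℂ A A] [SMulCommClass ℂ A A] [CompleteSpace A]
    [NonUnitalNormedRing B] [NormedSpace ℂ B]
    [IsScalarTower ℂ B B] [SMulCommClass ℂ B B] [CompleteSpace B]
    (hA : Biamenable.{u, v} A) (φ : A →L[ℂ] B) (hφ : ∀ a b, φ (a * b) = φ a * φ b)
    (hsurj : Function.Surjective φ) : Biamenable.{u, v} B := by
  intro X _ _ _ M D hD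
  obtain ⟨x, hx, h⟩ := hA X (M.restrictScalars φ hφ) (D.bilinearComp φ φ)
    ⟨fun a b c => by
      simp only [ContinuousLinearMap.bilinearComp_apply, hφ]
      exact hD.1 (φ a) (φ b) (φ c),
    fun a b c => by
      simp only [ContinuousLinearMap.bilinearComp_apply, hφ]
      exact hD.2 (φ a) (φ b) (φ c)⟩
  refine ⟨x, fun b => ?_, fun b c => ?_⟩
  · obtain ⟨a, rfl⟩ := hsurj b
    exact hx a
  · obtain ⟨a, rfl⟩ := hsurj b
    obtain ⟨a', rfl⟩ := hsurj c
    rw [← hφ, ← hφ, ← map_sub]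
    exact h a a'

/-- if `A` is a biamenable Banach algebra and `I` is a closed two-sided ideal
of `A`, then the quotient Banach algebra `A ⧸ I` is biamenable. -/
theorem quotient_biamenable_of_biamenable {A : Type u}
    [NonUnitalNormedRing A] [NormedSpace ℂ A] [IsScalarTower ℂ A A] [SMulCommClass ℂ A A]
    [CompleteSpace A]
    (I : Submodule ℂ A) (hl : ∀ (a : A), ∀ x ∈ I, a * x ∈ I)
    (hr : ∀ (a : A), ∀ x ∈ I, x * a ∈ I) (hc : IsClosed (I : Set A))
    (hbi : Biamenable.{u, v} A) :
    letI : NonUnitalNormedRing (A ⧸ I) := quotNonUnitalNormedRing I hl hr hc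
    letI : IsScalarTower ℂ (A ⧸ I) (A ⧸ I) := quotIsScalarTower I hl hr
    letI : SMulCommClass ℂ (A ⧸ I) (A ⧸ I) := quotSMulCommClass I hl hr
    Biamenable.{u, v} (A ⧸ I) := by
  letI : NonUnitalNormedRing (A ⧸ I) := quotNonUnitalNormedRing I hl hr hc
  letI : IsScalarTower ℂ (A ⧸ I) (A ⧸ I) := quotIsScalarTower I hl hr
  letI : SMulCommClass ℂ (A ⧸ I) (A ⧸ I) := quotSMulCommClass I hl hr
  exact hbi.of_surjective I.mkQL (fun _ _ => rfl) I.mkQ_surjective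
end
end
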